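/- Let f : ℕ → ℂ be bounded and let 1 ≤ q ≤ q' < ∞. Then f ∈ B^q implies f ∈ B^{q'}, and f ∈ A^q implies f ∈ A^{q'} (and conversely, for bounded f, membership in any of these closures for one exponent implies membership for every exponent 1 ≤ r < ∞). -/

import Mathlib

open MeasureTheory Filter Finset
open scoped Classical

/-- `e t = exp(2πit)`. -/
noncomputable def e (t : ℝ) : ℂ := Complex.exp (2 * Real.pi * Complex.I * t)

/-- `N` has (natural) density `ρ`. -/
def HasDensity (N : Set ℕ) (ρ : ℝ) : Prop :=
  Filter.Tendsto (fun x : ℕ => (((Finset.Icc 1 x).filter (fun n => n ∈ N)).card : ℝ) / x)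
    Filter.atTop (nhds ρ)

/-- `N` has density `d` in the residue class `a` modulo `q`. -/
def HasResidueDensity (N : Set ℕ) (q a : ℕ) (d : ℝ) : Prop :=
  Filter.Tendsto (fun x : ℕ =>
      (((Finset.Icc 1 x).filter (fun n => n ∈ N ∧ n % q = a % q)).card : ℝ) / x)
    Filter.atTop (nhds d)

/-- `N` is distributed: all residue class densities exist. -/
def Distributed (N : Set ℕ) : Prop := ∀ q, 1 ≤ q → ∀ a, ∃ d, HasResidueDensity N q a d

/-- The singular series `∑_{q≥1} ∑_{(a,q)=1} |∑_{b=1}^q (F(q,b)/ρ) e(ab/q)|²`. -/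
noncomputable def extremalSum (F : ℕ → ℕ → ℝ) (ρ : ℝ) : ℝ :=
  ∑' q : ℕ, ∑ a ∈ (Finset.Icc 1 q).filter (fun a => Nat.Coprime a q),
    ‖∑ b ∈ Finset.Icc 1 q, ((F q b / ρ : ℝ) : ℂ) * e (((a : ℝ) * b) / q)‖ ^ 2

/-- `N` is extremal. -/
def Extremal (N : Set ℕ) : Prop :=
  ∃ ρ : ℝ, 0 < ρ ∧ HasDensity N ρ ∧
    ∃ F : ℕ → ℕ → ℝ, (∀ q, 1 ≤ q → ∀ a, HasResidueDensity N q a (F q a)) ∧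
      1 / ρ = extremalSum F ρ

/-- `S(θ) = ∑_{n ≤ x, n ∈ N} e(θn)`. -/
noncomputable def expSum (N : Set ℕ) (x : ℕ) (θ : ℝ) : ℂ :=
  ∑ n ∈ (Finset.Icc 1 x).filter (fun n => n ∈ N), e (θ * n)

/-- Rational major arcs `M(x,Q)`. -/
def majorArcs (x Q : ℕ) : Set ℝ :=
  ⋃ q ∈ Finset.Icc 1 Q, ⋃ a ∈ (Finset.Icc 1 q).filter (fun a => Nat.Coprime a q),
    Set.Icc ((a : ℝ) / q - Q / x) ((a : ℝ) / q + Q / x)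

/-- Rational minor arcs `m(x,Q) = [0,1] \ M(x,Q)`. -/
def minorArcs (x Q : ℕ) : Set ℝ := Set.Icc 0 1 \ majorArcs x Q

/-- Characteristic function of a set of naturals. -/
noncomputable def charFun (N : Set ℕ) : ℕ → ℂ := fun n => if n ∈ N then 1 else 0

/-- A (nonconstant-period) periodic function on `ℕ`. -/
def IsPeriodicFn (g : ℕ → ℂ) : Prop := ∃ p : ℕ, 1 ≤ p ∧ ∀ n, g (n + p) = g n

/-- Trigonometric polynomials `n ↦ ∑ a_ν e(α_ν n)`. -/
def IsTrigPoly (g : ℕ → ℂ) : Prop :=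
  ∃ (k : ℕ) (a : Fin k → ℂ) (α : Fin k → ℝ), ∀ n : ℕ, g n = ∑ ν : Fin k, a ν * e (α ν * n)

/-- The seminorm `‖f‖₂ = (limsup_x (1/x) ∑_{n≤x} |f n|²)^{1/2}`. -/
noncomputable def seminorm2 (f : ℕ → ℂ) : ℝ :=
  Real.sqrt (Filter.limsup (fun x : ℕ => (∑ n ∈ Finset.Icc 1 x, ‖f n‖ ^ 2) / x) Filter.atTop)

/-- `f` lies in `A²`, the `‖·‖₂`-closure of the trigonometric polynomials. -/
def MemA2 (f : ℕ → ℂ) : Prop :=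
  ∀ ε : ℝ, 0 < ε → ∃ g : ℕ → ℂ, IsTrigPoly g ∧ seminorm2 (fun n => f n - g n) < ε

/-- `f` lies in `B²`, the `‖·‖₂`-closure of the periodic functions. -/
def MemB2 (f : ℕ → ℂ) : Prop :=
  ∀ ε : ℝ, 0 < ε → ∃ g : ℕ → ℂ, IsPeriodicFn g ∧ seminorm2 (fun n => f n - g n) < ε

/-- `f` is `B²`-almost periodic: there is a sequence of periodic functions `fq` with
`limsup_x (1/x) ∑_{n≤x} |f n - fq n|² → 0`. -/
def B2AlmostPeriodic (f : ℕ → ℂ) : Prop :=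
  ∃ fq : ℕ → ℕ → ℂ, (∀ q, IsPeriodicFn (fq q)) ∧
    Filter.Tendsto (fun q : ℕ =>
        Filter.limsup (fun x : ℕ => (∑ n ∈ Finset.Icc 1 x, ‖f n - fq q n‖ ^ 2) / x)
          Filter.atTop)
      Filter.atTop (nhds 0)

/-- The Fourier coefficient `⟨f, e_β⟩ = lim_x (1/x) ∑_{n≤x} f n e(-βn)` equals `c`. -/
def HasFourierCoeff (f : ℕ → ℂ) (β : ℝ) (c : ℂ) : Prop :=
  Filter.Tendsto (fun x : ℕ => (∑ n ∈ Finset.Icc 1 x, f n * e (-(β * n))) / (x : ℂ))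
    Filter.atTop (nhds c)

/-- The spectrum of `f`: those `β` with nonzero Fourier coefficient. -/
def spec (f : ℕ → ℂ) : Set ℝ := {β | ∃ c : ℂ, c ≠ 0 ∧ HasFourierCoeff f β c}

/-- Major arcs `M_α(x,Q)` relative to a sequence `α`. -/
def majorArcsAlpha (α : ℕ → ℝ) (x Q : ℕ) : Set ℝ :=
  ⋃ n : ℕ, ⋃ _ : n ≤ Q, Set.Icc (α n - Q / x) (α n + Q / x)

/-- Minor arcs `m_α(x,Q) = [0,1] \ M_α(x,Q)`. -/
def minorArcsAlpha (α : ℕ → ℝ) (x Q : ℕ) : Set ℝ := Set.Icc 0 1 \ majorArcsAlpha α x Q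

/-- `N` is `α`-extremal: it has positive density, all Fourier coefficients of its
characteristic function exist, and `∫_{m_α(x,Q(x))} |S|² = o(x)` for every `Q(x) → ∞`. -/
def AlphaExtremal (N : Set ℕ) (α : ℕ → ℝ) : Prop :=
  (∃ ρ : ℝ, 0 < ρ ∧ HasDensity N ρ) ∧
  (∀ β : ℝ, ∃ c : ℂ, HasFourierCoeff (charFun N) β c) ∧
  ∀ Q : ℕ → ℕ, Filter.Tendsto Q Filter.atTop Filter.atTop →
    Filter.Tendsto (fun x : ℕ =>
        (∫ θ in minorArcsAlpha α x (Q x), ‖expSum N x θ‖ ^ 2) / x)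
      Filter.atTop (nhds 0)

/-- The seminorm `‖f‖_r = (limsup_x (1/x) ∑_{n≤x} |f n|^r)^{1/r}` (real exponent `r`). -/
noncomputable def seminormP (r : ℝ) (f : ℕ → ℂ) : ℝ :=
  (Filter.limsup (fun x : ℕ => (∑ n ∈ Finset.Icc 1 x, ‖f n‖ ^ r) / x) Filter.atTop) ^ (1 / r)

/-- `f` lies in `A^r`, the `‖·‖_r`-closure of the trigonometric polynomials. -/
def MemAP (r : ℝ) (f : ℕ → ℂ) : Prop :=
  ∀ ε : ℝ, 0 < ε → ∃ g : ℕ → ℂ, IsTrigPoly g ∧ seminormP r (fun n => f n - g n) < ε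

/-- `f` lies in `B^r`, the `‖·‖_r`-closure of the periodic functions. -/
def MemBP (r : ℝ) (f : ℕ → ℂ) : Prop :=
  ∀ ε : ℝ, 0 < ε → ∃ g : ℕ → ℂ, IsPeriodicFn g ∧ seminormP r (fun n => f n - g n) < ε

lemma norm_e (t : ℝ) : ‖e t‖ = 1 := by
  have h : e t = Complex.exp (((2 * Real.pi * t : ℝ) : ℂ) * Complex.I) := by
    unfold e
    congr 1
    push_cast
    ring
  rw [h, Complex.norm_exp_ofReal_mul_I]

lemma e_zero : e 0 = 1 := by simp [e]

lemma e_add (s t : ℝ) : e (s + t) = e s * e t := by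
  unfold e
  rw [← Complex.exp_add]
  congr 1
  push_cast
  ring

lemma star_e (t : ℝ) : star (e t) = e (-t) := by
  simp [e, ← Complex.exp_conj, Complex.conj_ofNat]

lemma IsTrigPoly.of_fintype {ι : Type*} [Fintype ι] {g : ℕ → ℂ} (a : ι → ℂ) (α : ι → ℝ)
    (h : ∀ n : ℕ, g n = ∑ i, a i * e (α i * n)) : IsTrigPoly g := by
  let φ := (Fintype.equivFin ι).symm
  refine ⟨Fintype.card ι, a ∘ φ, α ∘ φ, fun n => ?_⟩
  rw [h n]
  exact (Equiv.sum_comp φ fun i => a i * e (α i * n)).symm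

lemma isTrigPoly_const (c : ℂ) : IsTrigPoly fun _ => c :=
  .of_fintype (ι := Unit) (fun _ => c) (fun _ => 0) fun n => by simp [e_zero]

lemma IsTrigPoly.add {g h : ℕ → ℂ} (hg : IsTrigPoly g) (hh : IsTrigPoly h) :
    IsTrigPoly fun n => g n + h n := by
  obtain ⟨k, a, α, hg⟩ := hg
  obtain ⟨l, b, β, hh⟩ := hh
  exact .of_fintype (Sum.elim a b) (Sum.elim α β) fun n => by simp [hg, hh]

lemma IsTrigPoly.mul {g h : ℕ → ℂ} (hg : IsTrigPoly g) (hh : IsTrigPoly h) :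
    IsTrigPoly fun n => g n * h n := by
  obtain ⟨k, a, α, hg⟩ := hg
  obtain ⟨l, b, β, hh⟩ := hh
  refine .of_fintype (ι := Fin k × Fin l) (fun i => a i.1 * b i.2) (fun i => α i.1 + β i.2)
    fun n => ?_
  rw [hg, hh, Finset.sum_mul_sum, Fintype.sum_prod_type]
  refine Finset.sum_congr rfl fun i _ => Finset.sum_congr rfl fun j _ => ?_
  rw [add_mul, e_add]
  ring

lemma IsTrigPoly.star {g : ℕ → ℂ} (hg : IsTrigPoly g) : IsTrigPoly fun n => star (g n) := by
  obtain ⟨k, a, α, hg⟩ := hg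
  refine ⟨k, fun i => Star.star (a i), fun i => -α i, fun n => ?_⟩
  simp only [hg, star_sum, star_mul', star_e, neg_mul]

lemma IsTrigPoly.exists_norm_le {g : ℕ → ℂ} (hg : IsTrigPoly g) : ∃ R : ℝ, ∀ n, ‖g n‖ ≤ R := by
  obtain ⟨k, a, α, hg⟩ := hg
  refine ⟨∑ i, ‖a i‖, fun n => ?_⟩
  rw [hg]
  refine (norm_sum_le _ _).trans_eq ?_
  simp [norm_e]

/-- Continuous functions of a trigonometric polynomial are uniform limits of trigonometric
polynomials. -/
lemma IsTrigPoly.exists_near_comp {g : ℕ → ℂ} (hg : IsTrigPoly g) {T : ℂ → ℂ}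
    (hT : Continuous T) {η : ℝ} (hη : 0 < η) :
    ∃ P : ℕ → ℂ, IsTrigPoly P ∧ ∀ n, ‖T (g n) - P n‖ ≤ η := by
  obtain ⟨R, hR⟩ := hg.exists_norm_le
  let s : Set ℂ := Metric.closedBall 0 R
  have : CompactSpace s := isCompact_iff_compactSpace.mp (isCompact_closedBall 0 R)
  let γ : ℕ → s := fun n => ⟨g n, by simpa [s] using hR n⟩
  let F : C(s, ℂ) := ⟨fun z => T z, hT.comp continuous_subtype_val⟩
  have hF : F ∈ (polynomialFunctions s).starClosure.topologicalClosure := by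
    rw [polynomialFunctions.starClosure_topologicalClosure]
    trivial
  obtain ⟨φ, hφ, hd⟩ := Metric.mem_closure_iff.mp hF η hη
  refine ⟨fun n => φ (γ n), ?_, fun n => ?_⟩
  · rw [SetLike.mem_coe, polynomialFunctions.starClosure_eq_adjoin_X] at hφ
    clear hd
    induction hφ using StarAlgebra.adjoin_induction with
    | mem x hx =>
      obtain rfl := Set.mem_singleton_iff.mp hx
      simpa [γ] using hg
    | algebraMap c => exact isTrigPoly_const c
    | add x y _ _ hx hy => exact hx.add hy
    | mul x y _ _ hx hy => exact hx.mul hy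
    | star x _ hx => exact hx.star
  · rw [← dist_eq_norm]
    exact (ContinuousMap.dist_apply_le_dist (f := F) (g := φ) (γ n)).trans hd.le

lemma IsPeriodicFn.exists_norm_le {g : ℕ → ℂ} (hg : IsPeriodicFn g) :
    ∃ R : ℝ, ∀ n, ‖g n‖ ≤ R := by
  obtain ⟨p, hp, hg⟩ := hg
  refine ⟨∑ i ∈ Finset.range p, ‖g i‖, fun n => ?_⟩
  rw [← Function.Periodic.map_mod_nat hg n]
  exact Finset.single_le_sum (f := fun i => ‖g i‖) (fun i _ => norm_nonneg _)
    (Finset.mem_range.mpr (Nat.mod_lt _ hp))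

/-- The radial retraction of `ℂ` onto the closed disc of radius `C`. -/
noncomputable def discRetraction (C : ℝ) (z : ℂ) : ℂ := (C / max C ‖z‖) • z

lemma continuous_discRetraction {C : ℝ} (hC : 0 < C) : Continuous (discRetraction C) :=
  (continuous_const.div (continuous_const.max continuous_norm)
    fun _ => (lt_max_of_lt_left hC).ne').smul continuous_id

lemma norm_discRetraction_le {C : ℝ} (hC : 0 < C) (z : ℂ) : ‖discRetraction C z‖ ≤ C := by
  have hm : 0 < max C ‖z‖ := lt_max_of_lt_left hC
  rw [discRetraction, norm_smul, Real.norm_of_nonneg (by positivity), div_mul_eq_mul_div,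
    div_le_iff₀ hm]
  exact mul_le_mul_of_nonneg_left (le_max_right _ _) hC.le

lemma norm_sub_discRetraction_le {C : ℝ} (hC : 0 < C) {w : ℂ} (hw : ‖w‖ ≤ C) (z : ℂ) :
    ‖w - discRetraction C z‖ ≤ 2 * ‖w - z‖ := by
  have key : ‖z - discRetraction C z‖ ≤ ‖w - z‖ := by
    rcases le_total ‖z‖ C with h | h
    · simp [discRetraction, max_eq_left h, div_self hC.ne']
    · have hz : 0 < ‖z‖ := hC.trans_le h
      have h1 : z - discRetraction C z = (1 - C / ‖z‖) • z := by
        rw [discRetraction, max_eq_right h, sub_smul, one_smul]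
      have h2 : 0 ≤ 1 - C / ‖z‖ := sub_nonneg.mpr ((div_le_one hz).mpr h)
      rw [h1, norm_smul, Real.norm_of_nonneg h2, sub_mul, one_mul, div_mul_cancel₀ _ hz.ne']
      have := norm_sub_norm_le z w
      rw [norm_sub_rev] at this
      linarith
  have := norm_sub_le_norm_sub_add_norm_sub w z (discRetraction C z)
  linarith

lemma average_le_of_le {u : ℕ → ℝ} {c : ℝ} (hc : 0 ≤ c) (h : ∀ n, u n ≤ c) (x : ℕ) :
    (∑ n ∈ Finset.Icc 1 x, u n) / x ≤ c := by
  refine div_le_of_le_mul₀ x.cast_nonneg hc ((Finset.sum_le_sum fun n _ => h n).trans_eq ?_)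
  simp [mul_comm]

lemma eventually_average_lt_of_seminormP_lt {r ε R : ℝ} (hr : 0 < r) (hε : 0 < ε) {h : ℕ → ℂ}
    (hR : ∀ n, ‖h n‖ ≤ R) (hlt : seminormP r h < ε) :
    ∀ᶠ x : ℕ in atTop, (∑ n ∈ Finset.Icc 1 x, ‖h n‖ ^ r) / x < ε ^ r := by
  have hR0 : 0 ≤ R := (norm_nonneg _).trans (hR 0)
  refine eventually_lt_of_limsup_lt ?_ (isBoundedUnder_of ⟨R ^ r, average_le_of_le (by positivity)
    fun n => Real.rpow_le_rpow (norm_nonneg _) (hR n) hr.le⟩)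
  by_contra! hle
  refine hlt.not_ge ?_
  calc ε = (ε ^ r) ^ (1 / r) := by rw [one_div, Real.rpow_rpow_inv hε.le hr.ne']
    _ ≤ _ := Real.rpow_le_rpow (by positivity) hle (by positivity)

lemma seminormP_le_of_eventually_average_le {r ε : ℝ} (hr : 0 < r) (hε : 0 ≤ ε) {h : ℕ → ℂ}
    (hle : ∀ᶠ x : ℕ in atTop, (∑ n ∈ Finset.Icc 1 x, ‖h n‖ ^ r) / x ≤ ε ^ r) :
    seminormP r h ≤ ε := by
  have h0 : ∀ x : ℕ, 0 ≤ (∑ n ∈ Finset.Icc 1 x, ‖h n‖ ^ r) / x := fun x => by positivity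
  have hlow : 0 ≤ limsup (fun x : ℕ => (∑ n ∈ Finset.Icc 1 x, ‖h n‖ ^ r) / x) atTop :=
    le_limsup_of_frequently_le (Frequently.of_forall h0) ⟨ε ^ r, hle⟩
  have hup := limsup_le_of_le (isCoboundedUnder_le_of_le atTop h0) hle
  calc seminormP r h ≤ (ε ^ r) ^ (1 / r) := Real.rpow_le_rpow hlow hup (by positivity)
    _ = ε := by rw [one_div, Real.rpow_rpow_inv hε hr.ne']

lemma rpow_le_add_mul_rpow {r q δ M t : ℝ} (hr : 0 < r) (hq : 0 < q) (hδ : 0 < δ)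
    (ht : 0 ≤ t) (htM : t ≤ M) :
    t ^ r ≤ δ + M ^ r / (δ ^ (1 / r)) ^ q * t ^ q := by
  have hM : 0 ≤ M := ht.trans htM
  rcases le_total (t ^ r) δ with h | h
  · have : 0 ≤ M ^ r / (δ ^ (1 / r)) ^ q * t ^ q := by positivity
    linarith
  · have h1 : δ ^ (1 / r) ≤ t := by
      rw [one_div]
      exact (Real.rpow_inv_le_iff_of_pos hδ.le ht hr).mpr h
    have h2 : (δ ^ (1 / r)) ^ q ≤ t ^ q := Real.rpow_le_rpow (by positivity) h1 hq.le
    have h3 : 0 < (δ ^ (1 / r)) ^ q := by positivity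
    calc t ^ r ≤ M ^ r := Real.rpow_le_rpow ht htM hr.le
      _ = M ^ r / (δ ^ (1 / r)) ^ q * (δ ^ (1 / r)) ^ q := by field_simp
      _ ≤ M ^ r / (δ ^ (1 / r)) ^ q * t ^ q := by gcongr
      _ ≤ _ := by linarith

lemma rpow_le_of_le_two_mul_add {q s t τ : ℝ} (hq : 0 < q) (hs : 0 ≤ s) (ht : 0 ≤ t) (hτ : 0 ≤ τ)
    (h : t ≤ 2 * s + τ) : t ^ q ≤ 4 ^ q * (s ^ q + τ ^ q) := by
  have h1 : t ≤ 4 * max s τ := by linarith [le_max_left s τ, le_max_right s τ]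
  have h2 : max s τ ^ q ≤ s ^ q + τ ^ q := by
    have := Real.rpow_nonneg hs q
    have := Real.rpow_nonneg hτ q
    rcases max_choice s τ with h | h <;> rw [h] <;> linarith
  calc t ^ q ≤ (4 * max s τ) ^ q := Real.rpow_le_rpow ht h1 hq.le
    _ = 4 ^ q * max s τ ^ q := Real.mul_rpow (by norm_num) (hs.trans (le_max_left _ _))
    _ ≤ _ := by gcongr

/-- A bounded function in the `‖·‖_q`-closure of a class of bounded functions lies in its
`‖·‖_r`-closure, provided the class is uniformly stable under retraction onto discs. -/
lemma exists_seminormP_lt_of_bounded {S : (ℕ → ℂ) → Prop}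
    (hS : ∀ g, S g → ∃ R : ℝ, ∀ n, ‖g n‖ ≤ R)
    (hST : ∀ g, S g → ∀ C : ℝ, 0 < C → ∀ η : ℝ, 0 < η →
      ∃ P, S P ∧ ∀ n, ‖discRetraction C (g n) - P n‖ ≤ η)
    {f : ℕ → ℂ} (hb : ∃ C : ℝ, ∀ n, ‖f n‖ ≤ C) {q r : ℝ} (hq : 1 ≤ q) (hr : 1 ≤ r)
    (hf : ∀ ε : ℝ, 0 < ε → ∃ g, S g ∧ seminormP q (fun n => f n - g n) < ε)
    {ε : ℝ} (hε : 0 < ε) : ∃ g, S g ∧ seminormP r (fun n => f n - g n) < ε := by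
  have hq0 : 0 < q := by linarith
  have hr0 : 0 < r := by linarith
  obtain ⟨C, hC, hfC⟩ : ∃ C : ℝ, 0 < C ∧ ∀ n, ‖f n‖ ≤ C := by
    obtain ⟨C, hC⟩ := hb
    exact ⟨max C 1, by positivity, fun n => (hC n).trans (le_max_left _ _)⟩
  set δ : ℝ := (ε / 2) ^ r / 2 with hδdef
  have hδ : 0 < δ := by positivity
  set M : ℝ := 2 * C + 1 with hM
  set K : ℝ := M ^ r / (δ ^ (1 / r)) ^ q with hK
  have hK0 : 0 < K := by positivity
  set τ : ℝ := min 1 (δ / (K * 4 ^ q * 2)) with hτdef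
  have hτ : 0 < τ := by positivity
  have hτ1 : τ ≤ 1 := min_le_left _ _
  have hτδ : K * 4 ^ q * 2 * τ ^ q ≤ δ := by
    have h1 : τ ^ q ≤ τ := Real.rpow_le_self_of_le_one hτ.le hτ1 hq
    rw [← le_div_iff₀' (by positivity)]
    exact h1.trans (min_le_right _ _)
  obtain ⟨g, hg, hgτ⟩ := hf τ hτ
  obtain ⟨R, hR⟩ := hS g hg
  obtain ⟨P, hP, hgP⟩ := hST g hg C hC τ hτ
  refine ⟨P, hP, lt_of_le_of_lt
    (seminormP_le_of_eventually_average_le hr0 (half_pos hε).le ?_) (half_lt_self hε)⟩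
  have hfg : ∀ n, ‖f n - g n‖ ≤ C + R := fun n =>
    (norm_sub_le _ _).trans (add_le_add (hfC n) (hR n))
  have hpt : ∀ n, ‖f n - P n‖ ^ r ≤ δ + K * 4 ^ q * τ ^ q + K * 4 ^ q * ‖f n - g n‖ ^ q := by
    intro n
    have h1 := norm_sub_le_norm_sub_add_norm_sub (f n) (discRetraction C (g n)) (P n)
    have h2 := norm_sub_discRetraction_le hC (hfC n) (g n)
    have h3 := norm_sub_le (f n) (discRetraction C (g n))
    have h4 := norm_discRetraction_le hC (g n)
    have h5 := hgP n
    have h6 := hfC n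
    calc ‖f n - P n‖ ^ r ≤ δ + K * ‖f n - P n‖ ^ q :=
          rpow_le_add_mul_rpow hr0 hq0 hδ (norm_nonneg _) (by linarith)
      _ ≤ δ + K * (4 ^ q * (‖f n - g n‖ ^ q + τ ^ q)) := by
          gcongr
          exact rpow_le_of_le_two_mul_add hq0 (norm_nonneg _) (norm_nonneg _) hτ.le (by linarith)
      _ = _ := by ring
  filter_upwards [eventually_average_lt_of_seminormP_lt hq0 hτ hfg hgτ] with x hx
  have h1 := average_le_of_le (u := fun n => ‖f n - P n‖ ^ r - K * 4 ^ q * ‖f n - g n‖ ^ q)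
    (c := δ + K * 4 ^ q * τ ^ q) (by positivity) (fun n => by linarith [hpt n]) x
  rw [Finset.sum_sub_distrib, ← Finset.mul_sum, sub_div, mul_div_assoc] at h1
  have h2 := mul_le_mul_of_nonneg_left hx.le (show 0 ≤ K * 4 ^ q by positivity)
  have h3 : (ε / 2) ^ r = 2 * δ := by rw [hδdef]; ring
  linarith

lemma MemBP.of_bounded {f : ℕ → ℂ} (hb : ∃ C : ℝ, ∀ n, ‖f n‖ ≤ C) {q r : ℝ} (hq : 1 ≤ q)
    (hr : 1 ≤ r) (hf : MemBP q f) : MemBP r f := fun _ hε =>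
  exists_seminormP_lt_of_bounded (fun _ hg => hg.exists_norm_le)
    (fun g ⟨p, hp, hg⟩ C _ η hη =>
      ⟨fun n => discRetraction C (g n), ⟨p, hp, fun n => congrArg _ (hg n)⟩, fun n => by simpa using hη.le⟩)
    hb hq hr hf hε

lemma MemAP.of_bounded {f : ℕ → ℂ} (hb : ∃ C : ℝ, ∀ n, ‖f n‖ ≤ C) {q r : ℝ} (hq : 1 ≤ q)
    (hr : 1 ≤ r) (hf : MemAP q f) : MemAP r f := fun _ hε =>
  exists_seminormP_lt_of_bounded (fun _ hg => hg.exists_norm_le)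
    (fun _ hg _ hC _ hη => hg.exists_near_comp (continuous_discRetraction hC) hη)
    hb hq hr hf hε

/-- for bounded `f` and `1 ≤ q ≤ q'`, `f ∈ B^q → f ∈ B^{q'}` and
`f ∈ A^q → f ∈ A^{q'}`; conversely, membership for one exponent implies membership
for every exponent `1 ≤ r < ∞`. -/
theorem stmt_17 (f : ℕ → ℂ) (hb : ∃ C : ℝ, ∀ n, ‖f n‖ ≤ C)
    (q q' : ℝ) (hq : 1 ≤ q) (hqq' : q ≤ q') :
    (MemBP q f → MemBP q' f) ∧ (MemAP q f → MemAP q' f) ∧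
    (MemBP q f → ∀ r : ℝ, 1 ≤ r → MemBP r f) ∧
    (MemAP q f → ∀ r : ℝ, 1 ≤ r → MemAP r f) :=
  ⟨fun h => h.of_bounded hb hq (hq.trans hqq'), fun h => h.of_bounded hb hq (hq.trans hqq'),
    fun h _ hr => h.of_bounded hb hq hr, fun h _ hr => h.of_bounded hb hq hr⟩
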